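/- arXiv:1407.3978 — 2 statements merged into one kernel-verified Lean document; each statement's English description precedes it below -/
import Mathlib

section
/- Let T be a Leibniz triple system over a field K of characteristic 0. Define T^0 = T, T^{n+1} = {T^n T T} + {T T^n T} + {T T T^n}, and define T^{(0)} = T, T^{(n+1)} = {T^{(n)} T T}. Then T^{(n)} = T^n for all n ∈ ℕ. -/
open TensorProduct

noncomputable section

variable {K : Type*} [Field K] [CharZero K]
variable {T : Type*} [AddCommGroup T] [Module K T]

/-- First defining identity of a Leibniz triple system:
`{a{bcd}e} = {{abc}de} − {{acb}de} − {{adb}ce} + {{adc}be}`. -/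
def LTS1 (t : T →ₗ[K] T →ₗ[K] T →ₗ[K] T) : Prop :=
  ∀ a b c d e : T,
    t a (t b c d) e =
      t (t a b c) d e - t (t a c b) d e - t (t a d b) c e + t (t a d c) b e

/-- Second defining identity of a Leibniz triple system:
`{ab{cde}} = {{abc}de} − {{abd}ce} − {{abe}cd} + {{abe}dc}`. -/
def LTS2 (t : T →ₗ[K] T →ₗ[K] T →ₗ[K] T) : Prop :=
  ∀ a b c d e : T,
    t a b (t c d e) =
      t (t a b c) d e - t (t a b d) c e - t (t a b e) c d + t (t a b e) d c

/-- The axioms of a Lie triple system. -/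
def IsLieTS (t : T →ₗ[K] T →ₗ[K] T →ₗ[K] T) : Prop :=
  (∀ a c : T, t a a c = 0) ∧
  (∀ a b c : T, t a b c + t b c a + t c a b = 0) ∧
  (∀ a b c d e : T,
    t a b (t c d e) = t (t a b c) d e + t c (t a b d) e + t c d (t a b e))

/-- The bracket of the universal Leibniz envelope `U(T) = T ⊕ (T ⊗ T)`,
determined by `[a,b] = a⊗b`, `[a⊗b,c] = {abc}`, `[a,b⊗c] = {abc} − {acb}`,
`[a⊗b,c⊗d] = {abc}⊗d − {abd}⊗c`. -/
def bkt (t : T →ₗ[K] T →ₗ[K] T →ₗ[K] T) (x y : T × (T ⊗[K] T)) :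
    T × (T ⊗[K] T) :=
  (TensorProduct.lift t x.2 y.1
      + TensorProduct.lift (t x.1) y.2 - TensorProduct.lift ((t x.1).flip) y.2,
   x.1 ⊗ₜ[K] y.1
      + LinearMap.rTensor T (TensorProduct.lift t x.2) y.2
      - LinearMap.rTensor T (TensorProduct.lift t x.2) (TensorProduct.comm K T T y.2))

/-- The induced bracket on the subalgebra `T ⊗ T` of `U(T)`. -/
def bktT (t : T →ₗ[K] T →ₗ[K] T →ₗ[K] T) (w w' : T ⊗[K] T) : T ⊗[K] T :=
  LinearMap.rTensor T (TensorProduct.lift t w) w'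
    - LinearMap.rTensor T (TensorProduct.lift t w) (TensorProduct.comm K T T w')

/-- `{ABC}`: the span of all products `{abc}` with `a ∈ A`, `b ∈ B`, `c ∈ C`. -/
def tspan (t : T →ₗ[K] T →ₗ[K] T →ₗ[K] T) (A B C : Submodule K T) : Submodule K T :=
  Submodule.span K {x | ∃ a ∈ A, ∃ b ∈ B, ∃ c ∈ C, x = t a b c}

/-- `I` is an ideal of the Leibniz triple system `(T, t)`. -/
def IsIdealT (t : T →ₗ[K] T →ₗ[K] T →ₗ[K] T) (I : Submodule K T) : Prop :=
  ∀ x ∈ I, ∀ a b : T, t x a b ∈ I ∧ t a x b ∈ I ∧ t a b x ∈ I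

/-- `i(I) = I ⊗ T + T ⊗ I` as a subspace of `T ⊗ T`. -/
def iI (I : Submodule K T) : Submodule K (T ⊗[K] T) :=
  Submodule.span K
    {z | (∃ x ∈ I, ∃ a : T, z = x ⊗ₜ[K] a) ∨ (∃ x ∈ I, ∃ a : T, z = a ⊗ₜ[K] x)}

/-- `j(I) = {w ∈ T⊗T | [w, T] + [T, w] ⊆ I}`. -/
def jI (t : T →ₗ[K] T →ₗ[K] T →ₗ[K] T) (I : Submodule K T) : Submodule K (T ⊗[K] T) :=
  ⨅ a : T,
    Submodule.comap ((TensorProduct.lift t).flip a) I ⊓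
      Submodule.comap (TensorProduct.lift (t a) - TensorProduct.lift ((t a).flip)) I

/-- `𝕀(I) = I + i(I)` as a subspace of `U(T)`. -/
def IU (I : Submodule K T) : Submodule K (T × (T ⊗[K] T)) := I.prod (iI I)

/-- `𝕁(I) = I + j(I)` as a subspace of `U(T)`. -/
def JU (t : T →ₗ[K] T →ₗ[K] T →ₗ[K] T) (I : Submodule K T) :
    Submodule K (T × (T ⊗[K] T)) := I.prod (jI t I)

/-- `V` is an ideal of the Leibniz algebra `T ⊗ T`. -/
def IsIdealTT (t : T →ₗ[K] T →ₗ[K] T →ₗ[K] T) (V : Submodule K (T ⊗[K] T)) : Prop :=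
  ∀ v ∈ V, ∀ w : T ⊗[K] T, bktT t v w ∈ V ∧ bktT t w v ∈ V

/-- `V` is an ideal of the Leibniz algebra `U(T)`. -/
def IsIdealU (t : T →ₗ[K] T →ₗ[K] T →ₗ[K] T) (V : Submodule K (T × (T ⊗[K] T))) : Prop :=
  ∀ v ∈ V, ∀ x : T × (T ⊗[K] T), bkt t v x ∈ V ∧ bkt t x v ∈ V

/-- The derived series of `I` relative to an ambient subsystem `S`:
`I⁰ = I`, `Iⁿ⁺¹ = {S Iⁿ Iⁿ} + {Iⁿ S Iⁿ} + {Iⁿ Iⁿ S}`. -/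
def derRel (t : T →ₗ[K] T →ₗ[K] T →ₗ[K] T) (S I : Submodule K T) : ℕ → Submodule K T
  | 0 => I
  | n + 1 =>
      tspan t S (derRel t S I n) (derRel t S I n) ⊔
        tspan t (derRel t S I n) S (derRel t S I n) ⊔
          tspan t (derRel t S I n) (derRel t S I n) S

/-- The derived series `I^[n]` of an ideal `I` of `T`:
`I^[0] = I`, `I^[n+1] = {T I^[n] I^[n]} + {I^[n] T I^[n]} + {I^[n] I^[n] T}`. -/
def derT (t : T →ₗ[K] T →ₗ[K] T →ₗ[K] T) (I : Submodule K T) : ℕ → Submodule K T :=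
  derRel t ⊤ I

/-- `I` is a solvable ideal of the Leibniz triple system `T`. -/
def IsSolvT (t : T →ₗ[K] T →ₗ[K] T →ₗ[K] T) (I : Submodule K T) : Prop :=
  ∃ k, derT t I k = ⊥

/-- The span of all brackets `[x, y]`, `x ∈ A`, `y ∈ B`, in `U(T)`. -/
def bspan (t : T →ₗ[K] T →ₗ[K] T →ₗ[K] T) (A B : Submodule K (T × (T ⊗[K] T))) :
    Submodule K (T × (T ⊗[K] T)) :=
  Submodule.span K {z | ∃ x ∈ A, ∃ y ∈ B, z = bkt t x y}

/-- The derived series of a subspace `V` of the Leibniz algebra `U(T)`. -/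
def derU (t : T →ₗ[K] T →ₗ[K] T →ₗ[K] T) (V : Submodule K (T × (T ⊗[K] T))) :
    ℕ → Submodule K (T × (T ⊗[K] T))
  | 0 => V
  | n + 1 => bspan t (derU t V n) (derU t V n)

/-- `V` is a solvable subspace of the Leibniz algebra `U(T)`. -/
def IsSolvU (t : T →ₗ[K] T →ₗ[K] T →ₗ[K] T) (V : Submodule K (T × (T ⊗[K] T))) : Prop :=
  ∃ k, derU t V k = ⊥

/-- The solvable radical `R(T)`: the sum of all solvable ideals of `T`. -/
def radT (t : T →ₗ[K] T →ₗ[K] T →ₗ[K] T) : Submodule K T :=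
  sSup {S : Submodule K T | IsIdealT t S ∧ IsSolvT t S}

/-- The solvable radical `Rad(U(T))`: the sum of all solvable ideals of `U(T)`. -/
def radU (t : T →ₗ[K] T →ₗ[K] T →ₗ[K] T) : Submodule K (T × (T ⊗[K] T)) :=
  sSup {V : Submodule K (T × (T ⊗[K] T)) | IsIdealU t V ∧ IsSolvU t V}

/-- `Ker(T)`: the span of all `{abc} − {acb} + {bca}`. -/
def kerT (t : T →ₗ[K] T →ₗ[K] T →ₗ[K] T) : Submodule K T :=
  Submodule.span K {x | ∃ a b c : T, x = t a b c - t a c b + t b c a}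

/-- `Ker(U(T))`: the span of all `[x, x]`, `x ∈ U(T)`. -/
def kerU (t : T →ₗ[K] T →ₗ[K] T →ₗ[K] T) : Submodule K (T × (T ⊗[K] T)) :=
  Submodule.span K {z | ∃ x : T × (T ⊗[K] T), z = bkt t x x}

/-- The central lower sequence of an ideal `I` of `T`: `I⁰ = I`,
`Iᵐ⁺¹ = {Iᵐ I T} + {Iᵐ T I} + {I Iᵐ T} + {I T Iᵐ} + {T I Iᵐ} + {T Iᵐ I}`. -/
def clsT (t : T →ₗ[K] T →ₗ[K] T →ₗ[K] T) (I : Submodule K T) : ℕ → Submodule K T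
  | 0 => I
  | m + 1 =>
      tspan t (clsT t I m) I ⊤ ⊔ tspan t (clsT t I m) ⊤ I ⊔
        tspan t I (clsT t I m) ⊤ ⊔ tspan t I ⊤ (clsT t I m) ⊔
          tspan t ⊤ I (clsT t I m) ⊔ tspan t ⊤ (clsT t I m) I

/-- `I` is a nilpotent ideal of the Leibniz triple system `T`. -/
def IsNilT (t : T →ₗ[K] T →ₗ[K] T →ₗ[K] T) (I : Submodule K T) : Prop :=
  ∃ n, clsT t I n = ⊥

/-- The lower central series of a subspace `V` of the Leibniz algebra `U(T)`:
`V⁰ = V`, `Vᵐ⁺¹ = [Vᵐ, V]`. -/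
def clsU (t : T →ₗ[K] T →ₗ[K] T →ₗ[K] T) (V : Submodule K (T × (T ⊗[K] T))) :
    ℕ → Submodule K (T × (T ⊗[K] T))
  | 0 => V
  | m + 1 => bspan t (clsU t V m) V

/-- `V` is a nilpotent subspace of the Leibniz algebra `U(T)`. -/
def IsNilU (t : T →ₗ[K] T →ₗ[K] T →ₗ[K] T) (V : Submodule K (T × (T ⊗[K] T))) : Prop :=
  ∃ n, clsU t V n = ⊥

/-- `Tⁿ`: the lower central series of `T`, `T⁰ = T`,
`Tⁿ⁺¹ = {Tⁿ T T} + {T Tⁿ T} + {T T Tⁿ}`. -/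
def lcsT (t : T →ₗ[K] T →ₗ[K] T →ₗ[K] T) : ℕ → Submodule K T
  | 0 => ⊤
  | n + 1 => tspan t (lcsT t n) ⊤ ⊤ ⊔ tspan t ⊤ (lcsT t n) ⊤ ⊔ tspan t ⊤ ⊤ (lcsT t n)

/-- `T⁽ⁿ⁾`: `T⁽⁰⁾ = T`, `T⁽ⁿ⁺¹⁾ = {T⁽ⁿ⁾ T T}`. -/
def powT (t : T →ₗ[K] T →ₗ[K] T →ₗ[K] T) : ℕ → Submodule K T
  | 0 => ⊤
  | n + 1 => tspan t (powT t n) ⊤ ⊤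


theorem mem_tspan {t : T →ₗ[K] T →ₗ[K] T →ₗ[K] T} {A B C : Submodule K T} {a b c : T}
    (ha : a ∈ A) (hb : b ∈ B) (hc : c ∈ C) : t a b c ∈ tspan t A B C :=
  Submodule.subset_span ⟨a, ha, b, hb, c, hc, rfl⟩

theorem tspan_le {t : T →ₗ[K] T →ₗ[K] T →ₗ[K] T} {A B C D : Submodule K T}
    (h : ∀ a ∈ A, ∀ b ∈ B, ∀ c ∈ C, t a b c ∈ D) : tspan t A B C ≤ D := by
  refine Submodule.span_le.2 ?_
  rintro _ ⟨a, ha, b, hb, c, hc, rfl⟩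
  exact h a ha b hb c hc

theorem mem_powT_succ {t : T →ₗ[K] T →ₗ[K] T →ₗ[K] T} {n : ℕ} {p : T} (hp : p ∈ powT t n)
    (b c : T) : t p b c ∈ powT t (n + 1) :=
  mem_tspan hp Submodule.mem_top Submodule.mem_top

/-- `{T⁽ⁱ⁾ T⁽ʲ⁾ T}` and `{T⁽ⁱ⁾ T T⁽ʲ⁾}` are contained in `T⁽ⁱ⁺ʲ⁺¹⁾`. -/
theorem mem_powT_add {t : T →ₗ[K] T →ₗ[K] T →ₗ[K] T} (h1 : LTS1 t) (h2 : LTS2 t) (j : ℕ) :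
    ∀ i : ℕ, ∀ a ∈ powT t i, ∀ x ∈ powT t j, ∀ e : T,
      t a x e ∈ powT t (i + j + 1) ∧ t a e x ∈ powT t (i + j + 1) := by
  induction j with
  | zero => exact fun i a ha x _ e => ⟨mem_powT_succ ha x e, mem_powT_succ ha e x⟩
  | succ j ih =>
    intro i a ha x hx e
    have key : powT t (j + 1) ≤
        (powT t (i + (j + 1) + 1)).comap ((t a).flip e) ⊓
          (powT t (i + (j + 1) + 1)).comap (t a e) := by
      refine tspan_le fun p hp c _ d _ => ?_
      have shift : i + 1 + j + 1 = i + (j + 1) + 1 := by omega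
      have first (c d e : T) : t (t a p c) d e ∈ powT t (i + (j + 1) + 1) :=
        mem_powT_succ (ih i a ha p hp c).1 d e
      have second (c d e : T) : t (t a c p) d e ∈ powT t (i + (j + 1) + 1) :=
        mem_powT_succ (ih i a ha p hp c).2 d e
      have third (c d e : T) : t (t a c d) p e ∈ powT t (i + (j + 1) + 1) :=
        shift ▸ (ih (i + 1) _ (mem_powT_succ ha c d) p hp e).1
      have fourth (c d e : T) : t (t a c d) e p ∈ powT t (i + (j + 1) + 1) :=
        shift ▸ (ih (i + 1) _ (mem_powT_succ ha c d) p hp e).2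
      simp only [Submodule.mem_inf, Submodule.mem_comap, LinearMap.flip_apply]
      rw [h1, h2]
      exact ⟨add_mem (sub_mem (sub_mem (first _ _ _) (second _ _ _)) (second _ _ _)) (third _ _ _),
        add_mem (sub_mem (sub_mem (second _ _ _) (third _ _ _)) (third _ _ _)) (fourth _ _ _)⟩
    exact key hx

/-- The two descending sequences `Tⁿ` (with `Tⁿ⁺¹ = {Tⁿ T T} + {T Tⁿ T} + {T T Tⁿ}`)
and `T⁽ⁿ⁾` (with `T⁽ⁿ⁺¹⁾ = {T⁽ⁿ⁾ T T}`) coincide. -/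
theorem lower_central_series_simplification
    (t : T →ₗ[K] T →ₗ[K] T →ₗ[K] T) (h1 : LTS1 t) (h2 : LTS2 t) :
    ∀ n : ℕ, powT t n = lcsT t n := by
  intro n
  induction n with
  | zero => rfl
  | succ n ih =>
    rw [lcsT, ← ih]
    refine le_antisymm (le_sup_of_le_left le_sup_left)
      (sup_le (sup_le le_rfl (tspan_le fun a _ x hx e _ => ?_)) (tspan_le fun a _ e _ x hx => ?_))
    · simpa using (mem_powT_add h1 h2 n 0 a Submodule.mem_top x hx e).1
    · simpa using (mem_powT_add h1 h2 n 0 a Submodule.mem_top x hx e).2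

end
end

section
/- Let T be a Leibniz triple system over a field K of characteristic 0 with universal Leibniz envelope U(T). Then: (1) an ideal I of T is nilpotent if and only if 𝕀(I) is a nilpotent ideal of the Leibniz algebra U(T); in particular T is nilpotent if and only if U(T) is a nilpotent Leibniz algebra; (2) if I and J are nilpotent ideals of T, then I + J is a nilpotent ideal of T. -/
open TensorProduct

noncomputable section

variable {K : Type*} [Field K] [CharZero K]
variable {T : Type*} [AddCommGroup T] [Module K T]

section LowerCentral

variable {F M : Type*} [CommRing F] [AddCommGroup M] [Module F M]

/-- The lower central series `V⁰ = V`, `Vⁿ⁺¹ = [Vⁿ, V]` of a subspace for a bilinear bracket. -/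
def lowerSeries (B : M →ₗ[F] M →ₗ[F] M) (V : Submodule F M) : ℕ → Submodule F M
  | 0 => V
  | n + 1 => Submodule.map₂ B (lowerSeries B V n) V

variable {B : M →ₗ[F] M →ₗ[F] M} {V : Submodule F M}

lemma bracket_mem_lowerSeries_succ {k : ℕ} {x w : M} (hx : x ∈ lowerSeries B V k ⊔ LinearMap.ker B)
    (hw : w ∈ V) : B x w ∈ lowerSeries B V (k + 1) := by
  obtain ⟨v, hv, n, hn, rfl⟩ := Submodule.mem_sup.1 hx
  rw [map_add, LinearMap.mem_ker.1 hn, add_zero]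
  exact Submodule.apply_mem_map₂ B hv hw

lemma mem_sup_ker_of_map_eq {W : Submodule F M} {x y : M} (h : B x = B y)
    (hy : y ∈ W ⊔ LinearMap.ker B) : x ∈ W ⊔ LinearMap.ker B := by
  have hxy : x - y ∈ LinearMap.ker B := by simp [h]
  simpa using add_mem (Submodule.mem_sup_right hxy) hy

lemma bracket_lowerSeries_mem
    (hB : ∀ x y z : M, B (B x (B y z)) = B (B (B x y) z) - B (B (B x z) y))
    {i j : ℕ} {x y : M} (hx : x ∈ lowerSeries B V i)
    (hy : y ∈ lowerSeries B V j) : B x y ∈ lowerSeries B V (i + j + 1) ⊔ LinearMap.ker B := by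
  induction j generalizing i x y with
  | zero => exact Submodule.mem_sup_left (Submodule.apply_mem_map₂ B hx hy)
  | succ j ih =>
    suffices h : lowerSeries B V (j + 1) ≤
        (lowerSeries B V (i + (j + 1) + 1) ⊔ LinearMap.ker B).comap (B x) from h hy
    refine Submodule.map₂_le.2 fun v hv w hw => ?_
    refine mem_sup_ker_of_map_eq (y := B (B x v) w - B (B x w) v) (by simp [hB]) ?_
    refine sub_mem (Submodule.mem_sup_left (bracket_mem_lowerSeries_succ (ih hx hv) hw)) ?_
    have := ih (i := i + 1) (Submodule.apply_mem_map₂ B hx hw) hv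
    rwa [show i + 1 + j + 1 = i + (j + 1) + 1 by omega] at this

lemma bracket_mem_lowerSeries_succ_right
    (hB : ∀ x y z : M, B (B x (B y z)) = B (B (B x y) z) - B (B (B x z) y))
    {k : ℕ} {w x : M} (hw : w ∈ V)
    (hx : x ∈ lowerSeries B V k) : B w x ∈ lowerSeries B V (k + 1) ⊔ LinearMap.ker B := by
  simpa only [zero_add] using bracket_lowerSeries_mem hB (i := 0) hw hx

lemma bracket_right_mem
    (hB : ∀ x y z : M, B (B x (B y z)) = B (B (B x y) z) - B (B (B x z) y))
    (hV : ∀ v ∈ V, ∀ u : M, B v u ∈ V ∧ B u v ∈ V)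
    {k : ℕ} {x : M} (hx : x ∈ lowerSeries B V k ⊔ LinearMap.ker B) (u : M) :
    B x u ∈ lowerSeries B V k ⊔ LinearMap.ker B := by
  suffices h : lowerSeries B V k ≤ (lowerSeries B V k ⊔ LinearMap.ker B).comap (B.flip u) by
    obtain ⟨v, hv, n, hn, rfl⟩ := Submodule.mem_sup.1 hx
    rw [map_add, LinearMap.mem_ker.1 hn, add_zero]
    exact h hv
  induction k generalizing x u with
  | zero => exact fun v hv => Submodule.mem_sup_left (hV v hv u).1
  | succ k ih =>
    refine Submodule.map₂_le.2 fun v hv w hw => ?_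
    have hv' := Submodule.mem_sup_left (T := LinearMap.ker B) hv
    refine mem_sup_ker_of_map_eq (y := B v (B w u) + B (B v u) w) (by simp [hB]) ?_
    exact Submodule.mem_sup_left (add_mem (bracket_mem_lowerSeries_succ hv' (hV w hw u).1)
      (bracket_mem_lowerSeries_succ (ih hv' u hv) hw))

lemma bracket_left_mem
    (hB : ∀ x y z : M, B (B x (B y z)) = B (B (B x y) z) - B (B (B x z) y))
    (hV : ∀ v ∈ V, ∀ u : M, B v u ∈ V ∧ B u v ∈ V)
    {k : ℕ} {x : M} (hx : x ∈ lowerSeries B V k) (u : M) :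
    B u x ∈ lowerSeries B V k ⊔ LinearMap.ker B := by
  induction k generalizing x with
  | zero => exact Submodule.mem_sup_left (hV x hx u).2
  | succ k ih =>
    suffices h : lowerSeries B V (k + 1) ≤
        (lowerSeries B V (k + 1) ⊔ LinearMap.ker B).comap (B u) from h hx
    refine Submodule.map₂_le.2 fun v hv w hw => ?_
    refine mem_sup_ker_of_map_eq (y := B (B u v) w - B (B u w) v) (by simp [hB]) ?_
    refine sub_mem (Submodule.mem_sup_left (bracket_mem_lowerSeries_succ (ih hv) hw)) ?_
    exact bracket_mem_lowerSeries_succ_right hB (hV w hw u).2 hv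

end LowerCentral

section TripleSystem

variable {F X : Type*} [Field F] [AddCommGroup X] [Module F X] {t : X →ₗ[F] X →ₗ[F] X →ₗ[F] X}

lemma tspan_le_s19 {A B C P : Submodule F X} :
    tspan t A B C ≤ P ↔ ∀ a ∈ A, ∀ b ∈ B, ∀ c ∈ C, t a b c ∈ P := by
  refine Submodule.span_le.trans ⟨fun h a ha b hb c hc => h ⟨a, ha, b, hb, c, hc, rfl⟩, ?_⟩
  rintro h _ ⟨a, ha, b, hb, c, hc, rfl⟩
  exact h a ha b hb c hc

/-- The span of all products `{xyz}` having one factor in `A` and another factor in `B`. -/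
def mixedSpan (t : X →ₗ[F] X →ₗ[F] X →ₗ[F] X) (A B : Submodule F X) : Submodule F X :=
  tspan t A B ⊤ ⊔ tspan t A ⊤ B ⊔ tspan t B A ⊤ ⊔ tspan t B ⊤ A ⊔ tspan t ⊤ B A ⊔ tspan t ⊤ A B

lemma clsT_succ (I : Submodule F X) (m : ℕ) :
    clsT t I (m + 1) = mixedSpan t (clsT t I m) I := rfl

lemma mixedSpan_le {A B P : Submodule F X} :
    mixedSpan t A B ≤ P ↔ ∀ a ∈ A, ∀ b ∈ B, ∀ c, t a b c ∈ P ∧ t a c b ∈ P ∧ t b a c ∈ P ∧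
      t b c a ∈ P ∧ t c a b ∈ P ∧ t c b a ∈ P := by
  simp only [mixedSpan, sup_le_iff, tspan_le_s19]
  constructor
  · rintro ⟨⟨⟨⟨⟨h1, h2⟩, h3⟩, h4⟩, h5⟩, h6⟩ a ha b hb c
    exact ⟨h1 a ha b hb c trivial, h2 a ha c trivial b hb, h3 b hb a ha c trivial,
      h4 b hb c trivial a ha, h6 c trivial a ha b hb, h5 c trivial b hb a ha⟩
  · intro h
    exact ⟨⟨⟨⟨⟨fun a ha b hb c _ => (h a ha b hb c).1,
      fun a ha c _ b hb => (h a ha b hb c).2.1⟩,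
      fun b hb a ha c _ => (h a ha b hb c).2.2.1⟩,
      fun b hb c _ a ha => (h a ha b hb c).2.2.2.1⟩,
      fun c _ b hb a ha => (h a ha b hb c).2.2.2.2.2⟩,
      fun c _ a ha b hb => (h a ha b hb c).2.2.2.2.1⟩

lemma mem_mixedSpan {A B : Submodule F X} {a b : X} (ha : a ∈ A) (hb : b ∈ B) (c : X) :
    t a b c ∈ mixedSpan t A B ∧ t a c b ∈ mixedSpan t A B ∧ t b a c ∈ mixedSpan t A B ∧
      t b c a ∈ mixedSpan t A B ∧ t c a b ∈ mixedSpan t A B ∧ t c b a ∈ mixedSpan t A B :=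
  mixedSpan_le.1 le_rfl a ha b hb c

lemma mixedSpan_le_swap (A B : Submodule F X) : mixedSpan t A B ≤ mixedSpan t B A := by
  refine mixedSpan_le.2 fun a ha b hb c => ?_
  obtain ⟨h1, h2, h3, h4, h5, h6⟩ := mem_mixedSpan (t := t) hb ha c
  exact ⟨h3, h4, h1, h2, h6, h5⟩

/-- Two of the three entries `p`, `q`, `r` lie one in `A` and the other in `B`. -/
def MixedTriple (A B : Submodule F X) (p q r : X) : Prop :=
  p ∈ A ∧ q ∈ B ∨ p ∈ A ∧ r ∈ B ∨ q ∈ A ∧ r ∈ B ∨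
  p ∈ B ∧ q ∈ A ∨ p ∈ B ∧ r ∈ A ∨ q ∈ B ∧ r ∈ A

/-- The identity `LTS2` moves a factor in `B` outwards past a pair `p, q`. -/
lemma IsIdealT.mixed_third_right_mem (h2 : LTS2 t) {A B : Submodule F X} (hA : IsIdealT t A)
    (hB : IsIdealT t B) {p q b : X} (hpq : p ∈ A ∨ q ∈ A) (hb : b ∈ B) (c d : X) :
    t (t p q b) c d ∈ mixedSpan t A B := by
  have hin : ∀ r, t p q r ∈ A := fun r =>
    hpq.elim (fun h => (hA p h q r).1) (fun h => (hA q h p r).2.1)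
  have hlast : ∀ y ∈ B, t p q y ∈ mixedSpan t A B := fun y hy =>
    hpq.elim (fun h => (mem_mixedSpan h hy q).2.1) (fun h => (mem_mixedSpan h hy p).2.2.2.2.1)
  have e : t (t p q b) c d
      = t p q (t b c d) + t (t p q c) b d + t (t p q d) b c - t (t p q d) c b := by
    rw [h2]; abel
  rw [e]
  exact sub_mem (add_mem (add_mem (hlast _ (hB b hb c d).1) (mem_mixedSpan (hin c) hb d).1)
    (mem_mixedSpan (hin d) hb c).1) (mem_mixedSpan (hin d) hb c).2.1

lemma IsIdealT.mixed_right_mem (h1 : LTS1 t) (h2 : LTS2 t) {A B : Submodule F X}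
    (hA : IsIdealT t A) (hB : IsIdealT t B) {p q r : X}
    (h : MixedTriple A B p q r) (c d : X) :
    t (t p q r) c d ∈ mixedSpan t A B := by
  have first_second : ∀ {A B : Submodule F X}, IsIdealT t A → IsIdealT t B →
      ∀ a ∈ A, ∀ b ∈ B, ∀ x, t (t a b x) c d ∈ mixedSpan t A B := by
    intro A B hA hB a ha b hb x
    have e : t (t a b x) c d
        = t a (t b x c) d + t (t a x b) c d + t (t a c b) x d - t (t a c x) b d := by
      rw [h1]; abel
    rw [e]
    exact sub_mem (add_mem (add_mem (mem_mixedSpan ha (hB b hb x c).1 d).1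
      (hA.mixed_third_right_mem h2 hB (.inl ha) hb c d))
      (hA.mixed_third_right_mem h2 hB (.inl ha) hb x d)) (mem_mixedSpan (hA a ha c x).1 hb d).1
  have swap := mixedSpan_le_swap (t := t) B A
  rcases h with ⟨hp, hq⟩ | ⟨hp, hr⟩ | ⟨hq, hr⟩ | ⟨hp, hq⟩ | ⟨hp, hr⟩ | ⟨hq, hr⟩
  · exact first_second hA hB p hp q hq r
  · exact hA.mixed_third_right_mem h2 hB (.inl hp) hr c d
  · exact hA.mixed_third_right_mem h2 hB (.inr hq) hr c d
  · exact swap (first_second hB hA p hp q hq r)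
  · exact swap (hB.mixed_third_right_mem h2 hA (.inl hp) hr c d)
  · exact swap (hB.mixed_third_right_mem h2 hA (.inr hq) hr c d)

lemma IsIdealT.mem_of_factor {A : Submodule F X} (hA : IsIdealT t A) {p q r : X}
    (h : p ∈ A ∨ q ∈ A ∨ r ∈ A) : t p q r ∈ A := by
  rcases h with h | h | h
  exacts [(hA p h q r).1, (hA q h p r).2.1, (hA r h p q).2.2]

lemma isIdealT_mixedSpan (h1 : LTS1 t) (h2 : LTS2 t) {A B : Submodule F X}
    (hA : IsIdealT t A) (hB : IsIdealT t B) : IsIdealT t (mixedSpan t A B) := by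
  have two_three : ∀ {u v w y z : X}, (MixedTriple A B u v w ∨
      (u ∈ A ∨ v ∈ A ∨ w ∈ A) ∧ (y ∈ B ∨ z ∈ B) ∨ (u ∈ B ∨ v ∈ B ∨ w ∈ B) ∧ (y ∈ A ∨ z ∈ A) ∨
      y ∈ A ∧ z ∈ B ∨ y ∈ B ∧ z ∈ A) → t (t u v w) y z ∈ mixedSpan t A B := by
    rintro u v w y z (h | ⟨h, hy | hz⟩ | ⟨h, hy | hz⟩ | ⟨hy, hz⟩ | ⟨hy, hz⟩)
    · exact hA.mixed_right_mem h1 h2 hB h y z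
    · exact (mem_mixedSpan (hA.mem_of_factor h) hy z).1
    · exact (mem_mixedSpan (hA.mem_of_factor h) hz y).2.1
    · exact (mem_mixedSpan hy (hB.mem_of_factor h) z).2.2.1
    · exact (mem_mixedSpan hz (hB.mem_of_factor h) y).2.2.2.1
    · exact (mem_mixedSpan hy hz _).2.2.2.2.1
    · exact (mem_mixedSpan hz hy _).2.2.2.2.2
  have gen : ∀ {p q r : X}, MixedTriple A B p q r → ∀ c d,
      t (t p q r) c d ∈ mixedSpan t A B ∧ t c (t p q r) d ∈ mixedSpan t A B ∧
        t c d (t p q r) ∈ mixedSpan t A B := by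
    intro p q r h c d
    refine ⟨hA.mixed_right_mem h1 h2 hB h c d, ?_, ?_⟩
    · rw [h1]
      refine add_mem (sub_mem (sub_mem ?_ ?_) ?_) ?_ <;>
      · refine two_three ?_
        rcases h with ⟨h, h'⟩ | ⟨h, h'⟩ | ⟨h, h'⟩ | ⟨h, h'⟩ | ⟨h, h'⟩ | ⟨h, h'⟩ <;>
          simp [MixedTriple, h, h']
    · rw [h2]
      refine add_mem (sub_mem (sub_mem ?_ ?_) ?_) ?_ <;>
      · refine two_three ?_
        rcases h with ⟨h, h'⟩ | ⟨h, h'⟩ | ⟨h, h'⟩ | ⟨h, h'⟩ | ⟨h, h'⟩ | ⟨h, h'⟩ <;>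
          simp [h, h']
  intro x hx c d
  let Q : Submodule F X := (mixedSpan t A B).comap ((t.flip c).flip d) ⊓
    ((mixedSpan t A B).comap ((t c).flip d) ⊓ (mixedSpan t A B).comap (t c d))
  suffices h : mixedSpan t A B ≤ Q from h hx
  refine mixedSpan_le.2 fun a ha b hb e => ⟨gen ?_ c d, gen ?_ c d, gen ?_ c d, gen ?_ c d,
    gen ?_ c d, gen ?_ c d⟩ <;> simp [MixedTriple, ha, hb]

lemma isIdealT_clsT (h1 : LTS1 t) (h2 : LTS2 t) {I : Submodule F X} (hI : IsIdealT t I) (m : ℕ) :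
    IsIdealT t (clsT t I m) := by
  induction m with
  | zero => exact hI
  | succ m ih => exact isIdealT_mixedSpan h1 h2 ih hI

lemma mixedSpan_le_left {A : Submodule F X} (hA : IsIdealT t A) (B : Submodule F X) :
    mixedSpan t A B ≤ A :=
  mixedSpan_le.2 fun a ha b _ c => ⟨(hA a ha b c).1, (hA a ha c b).1, (hA a ha b c).2.1,
    (hA a ha b c).2.2, (hA a ha c b).2.1, (hA a ha c b).2.2⟩

lemma mixedSpan_iSup_sup_le {ι : Sort*} {f : ι → Submodule F X} {B C P : Submodule F X}
    (hB : ∀ i, mixedSpan t (f i) B ≤ P) (hC : ∀ i, mixedSpan t (f i) C ≤ P) :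
    mixedSpan t (⨆ i, f i) (B ⊔ C) ≤ P := by
  refine mixedSpan_le.2 fun a ha y hy c => ?_
  obtain ⟨b, hb, b', hb', rfl⟩ := Submodule.mem_sup.1 hy
  induction ha using Submodule.iSup_induction' with
  | mem i a ha =>
    obtain ⟨h1, h2, h3, h4, h5, h6⟩ := mixedSpan_le.1 (hB i) a ha b hb c
    obtain ⟨k1, k2, k3, k4, k5, k6⟩ := mixedSpan_le.1 (hC i) a ha b' hb' c
    simp only [map_add, LinearMap.add_apply]
    exact ⟨add_mem h1 k1, add_mem h2 k2, add_mem h3 k3, add_mem h4 k4, add_mem h5 k5,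
      add_mem h6 k6⟩
  | zero => simp
  | add a a' _ _ h k =>
    obtain ⟨h1, h2, h3, h4, h5, h6⟩ := h
    obtain ⟨k1, k2, k3, k4, k5, k6⟩ := k
    simp only [map_add t a, (t _).map_add a, (t _ _).map_add a, LinearMap.add_apply _ _ (b + b'),
      LinearMap.add_apply _ _ c]
    exact ⟨add_mem h1 k1, add_mem h2 k2, add_mem h3 k3, add_mem h4 k4, add_mem h5 k5,
      add_mem h6 k6⟩

lemma isIdealT_sup {I J : Submodule F X} (hI : IsIdealT t I) (hJ : IsIdealT t J) :
    IsIdealT t (I ⊔ J) := by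
  intro x hx a b
  obtain ⟨y, hy, z, hz, rfl⟩ := Submodule.mem_sup.1 hx
  simp only [map_add, LinearMap.add_apply]
  exact ⟨Submodule.add_mem_sup (hI y hy a b).1 (hJ z hz a b).1,
    Submodule.add_mem_sup (hI y hy a b).2.1 (hJ z hz a b).2.1,
    Submodule.add_mem_sup (hI y hy a b).2.2 (hJ z hz a b).2.2⟩

/-- The central lower sequence of `I`, preceded by the whole of `T`. -/
def augSeries (t : X →ₗ[F] X →ₗ[F] X →ₗ[F] X) (I : Submodule F X) : ℕ → Submodule F X
  | 0 => ⊤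
  | m + 1 => clsT t I m

lemma isIdealT_augSeries (h1 : LTS1 t) (h2 : LTS2 t) {I : Submodule F X} (hI : IsIdealT t I)
    (m : ℕ) : IsIdealT t (augSeries t I m) := by
  cases m with
  | zero => exact fun _ _ _ _ => ⟨trivial, trivial, trivial⟩
  | succ m => exact isIdealT_clsT h1 h2 hI m

lemma mixedSpan_augSeries_le {I : Submodule F X} (hI : IsIdealT t I) (m : ℕ) :
    mixedSpan t (augSeries t I m) I ≤ augSeries t I (m + 1) := by
  cases m with
  | zero => exact (mixedSpan_le_swap _ _).trans (mixedSpan_le_left hI _)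
  | succ m => exact le_rfl

lemma augSeries_eq_bot {I : Submodule F X} {n : ℕ} (hn : clsT t I n = ⊥) {m : ℕ} (hm : n < m) :
    augSeries t I m = ⊥ := by
  obtain ⟨k, rfl⟩ := Nat.exists_eq_add_of_lt hm
  change clsT t I (n + k) = ⊥
  induction k with
  | zero => exact hn
  | succ k ih =>
    refine eq_bot_iff.2 ((clsT_succ I (n + k)).trans_le (mixedSpan_le.2 fun a ha b _ c => ?_))
    rw [ih (by omega), Submodule.mem_bot] at ha
    simp [ha]

lemma clsT_sup_le (h1 : LTS1 t) (h2 : LTS2 t) {I J : Submodule F X} (hI : IsIdealT t I)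
    (hJ : IsIdealT t J) (m : ℕ) : clsT t (I ⊔ J) m ≤
      ⨆ p : {p : ℕ × ℕ // p.1 + p.2 = m + 1}, augSeries t I p.1.1 ⊓ augSeries t J p.1.2 := by
  induction m with
  | zero =>
    refine sup_le ?_ ?_
    · exact le_iSup_of_le ⟨(1, 0), by simp⟩ (le_inf le_rfl le_top)
    · exact le_iSup_of_le ⟨(0, 1), by simp⟩ (le_inf le_top le_rfl)
  | succ m ih =>
    have mono : ∀ {A A' B : Submodule F X}, A ≤ A' → mixedSpan t A B ≤ mixedSpan t A' B :=
      fun h => mixedSpan_le.2 fun a ha b hb c => mem_mixedSpan (h ha) hb c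
    refine ((clsT_succ _ m).trans_le (mono ih)).trans (mixedSpan_iSup_sup_le ?_ ?_)
    · rintro ⟨⟨p, q⟩, hpq⟩
      refine le_iSup_of_le ⟨(p + 1, q), by simp only at hpq ⊢; omega⟩ (le_inf ?_ ?_)
      · exact (mono inf_le_left).trans (mixedSpan_augSeries_le hI p)
      · exact (mono inf_le_right).trans (mixedSpan_le_left (isIdealT_augSeries h1 h2 hJ q) I)
    · rintro ⟨⟨p, q⟩, hpq⟩
      refine le_iSup_of_le ⟨(p, q + 1), by simp only at hpq ⊢; omega⟩ (le_inf ?_ ?_)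
      · exact (mono inf_le_left).trans (mixedSpan_le_left (isIdealT_augSeries h1 h2 hI p) J)
      · exact (mono inf_le_right).trans (mixedSpan_augSeries_le hJ q)

lemma isNilT_sup (h1 : LTS1 t) (h2 : LTS2 t) {I J : Submodule F X} (hI : IsIdealT t I)
    (hI' : IsNilT t I) (hJ : IsIdealT t J) (hJ' : IsNilT t J) : IsNilT t (I ⊔ J) := by
  obtain ⟨m, hm⟩ := hI'
  obtain ⟨n, hn⟩ := hJ'
  refine ⟨m + n, eq_bot_iff.2 ((clsT_sup_le h1 h2 hI hJ _).trans (iSup_le ?_))⟩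
  rintro ⟨⟨p, q⟩, hpq⟩
  replace hpq : p + q = m + n + 1 := hpq
  by_cases hp : m < p
  · exact inf_le_left.trans (augSeries_eq_bot hm hp).le
  · exact inf_le_right.trans (augSeries_eq_bot hn (show n < q by omega)).le

/-- The bracket of `U(T)` as a bilinear map. -/
def bktHom (t : X →ₗ[F] X →ₗ[F] X →ₗ[F] X) :
    (X × (X ⊗[F] X)) →ₗ[F] (X × (X ⊗[F] X)) →ₗ[F] (X × (X ⊗[F] X)) :=
  LinearMap.mk₂ F (bkt t)
    (fun x x' y => by
      ext1
      · have h : lift (t (x.1 + x'.1)) = lift (t x.1) + lift (t x'.1) :=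
          TensorProduct.ext' (by simp)
        have h' : lift (t (x.1 + x'.1)).flip = lift (t x.1).flip + lift (t x'.1).flip :=
          TensorProduct.ext' (by simp)
        simp only [bkt, Prod.fst_add, Prod.snd_add]
        rw [h, h', map_add (lift t)]
        simp only [LinearMap.add_apply]
        abel
      · simp [bkt, TensorProduct.add_tmul, LinearMap.rTensor_add]; abel)
    (fun c x y => by
      ext1
      · have h : lift (t (c • x.1)) = c • lift (t x.1) := TensorProduct.ext' (by simp)
        have h' : lift (t (c • x.1)).flip = c • lift (t x.1).flip :=
          TensorProduct.ext' (by simp)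
        simp only [bkt, Prod.smul_fst, Prod.smul_snd]
        rw [h, h', map_smul (lift t)]
        simp only [LinearMap.smul_apply, smul_add, smul_sub]
      · simp [bkt, TensorProduct.smul_tmul', LinearMap.rTensor_smul, smul_add, smul_sub])
    (fun x y y' => by
      ext1
      · simp [bkt]; abel
      · simp [bkt, TensorProduct.tmul_add]; abel)
    (fun c x y => by
      ext1
      · simp [bkt, smul_add, smul_sub]
      · simp [bkt, smul_add, smul_sub])

lemma bktHom_apply (x y : X × (X ⊗[F] X)) : bktHom t x y = bkt t x y := rfl

lemma clsU_eq_lowerSeries (V : Submodule F (X × (X ⊗[F] X))) (n : ℕ) :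
    clsU t V n = lowerSeries (bktHom t) V n := by
  induction n with
  | zero => rfl
  | succ n ih =>
    rw [clsU, bspan, ih, lowerSeries, Submodule.map₂_eq_span_image2]
    congr 1
    ext z
    simp [Set.mem_image2, bktHom_apply, eq_comm]

lemma bkt_tmul (x : X × (X ⊗[F] X)) (c d : X) :
    bktHom t x (0, c ⊗ₜ d) = bktHom t (bktHom t x (c, 0)) (d, 0)
      - bktHom t (bktHom t x (d, 0)) (c, 0) := by
  ext1 <;> simp [bktHom_apply, bkt]

lemma bkt_left (x y : X) : bktHom t (x, 0) (y, 0) = (0, x ⊗ₜ y) := by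
  simp [bktHom_apply, bkt]

lemma bkt_tmul_left (x y z : X) : bktHom t (0, x ⊗ₜ y) (z, 0) = (t x y z, 0) := by
  simp [bktHom_apply, bkt]

/-- Elements of `U(T)` can be tested on `T` and on pure tensors. -/
lemma envelope_induction {p : X × (X ⊗[F] X) → Prop} (x : X × (X ⊗[F] X))
    (left : ∀ a, p (a, 0)) (tmul : ∀ a b, p (0, a ⊗ₜ b))
    (add : ∀ x y, p x → p y → p (x + y)) : p x := by
  obtain ⟨a, w⟩ := x
  have hw : p (0, w) := by
    induction w with
    | zero => exact left 0
    | tmul a b => exact tmul a b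
    | add v w hv hw => simpa using add _ _ hv hw
  simpa using add _ _ (left a) hw

lemma bkt_bkt_triple (h1 : LTS1 t) (h2 : LTS2 t) (x e : X × (X ⊗[F] X)) (b c d : X) :
    bktHom t (bktHom t x (t b c d, 0)) e
      = bktHom t (bktHom t (bktHom t x (0, b ⊗ₜ c)) (d, 0)) e
        - bktHom t (bktHom t (bktHom t x (d, 0)) (0, b ⊗ₜ c)) e := by
  have on_T : ∀ p : X, bktHom t (bktHom t x (t b c d, 0)) (p, 0)
      = bktHom t (bktHom t (bktHom t x (0, b ⊗ₜ c)) (d, 0)) (p, 0)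
        - bktHom t (bktHom t (bktHom t x (d, 0)) (0, b ⊗ₜ c)) (p, 0) := by
    intro p
    induction x using envelope_induction with
    | left a =>
      simp only [bkt_tmul, map_sub, LinearMap.sub_apply, bkt_left, bkt_tmul_left, h1 a b c d p]
      ext1 <;> simp
      abel
    | tmul a a' =>
      simp only [bkt_tmul, map_sub, LinearMap.sub_apply, bkt_left, bkt_tmul_left, h2 a a' b c d,
        TensorProduct.add_tmul, TensorProduct.sub_tmul]
      ext1 <;> simp
      abel
    | add x y hx hy =>
      simp only [map_add, LinearMap.add_apply, hx, hy]
      abel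
  induction e using envelope_induction with
  | left p => exact on_T p
  | tmul p q =>
    simp only [bkt_tmul _ p q, on_T, map_sub, LinearMap.sub_apply]
    abel
  | add p q hp hq =>
    simp only [map_add, hp, hq]
    abel

/-- The Leibniz identity holds in `U(T)` up to the left annihilator of `U(T)`. -/
lemma bkt_bkt_leibniz (h1 : LTS1 t) (h2 : LTS2 t) (x y z e : X × (X ⊗[F] X)) :
    bktHom t (bktHom t x (bktHom t y z)) e
      = bktHom t (bktHom t (bktHom t x y) z) e
        - bktHom t (bktHom t (bktHom t x z) y) e := by
  induction y using envelope_induction with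
  | add y y' hy hy' =>
    simp only [map_add, LinearMap.add_apply, hy, hy']
    abel
  | left b =>
    induction z using envelope_induction with
    | add z z' hz hz' =>
      simp only [map_add, LinearMap.add_apply, hz, hz']
      abel
    | left c => simp only [bkt_left, bkt_tmul, map_sub, LinearMap.sub_apply]
    | tmul c d =>
      simp only [bkt_tmul (b, 0), bkt_left, bkt_tmul_left, map_sub, bkt_bkt_triple h1 h2,
        LinearMap.sub_apply, bkt_tmul]
      abel
  | tmul b c =>
    induction z using envelope_induction with
    | add z z' hz hz' =>
      simp only [map_add, LinearMap.add_apply, hz, hz']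
      abel
    | left d =>
      simp only [bkt_tmul_left, bkt_bkt_triple h1 h2]
    | tmul d d' =>
      simp only [bkt_tmul (0, b ⊗ₜ c), bkt_left, bkt_tmul_left, map_sub, bkt_bkt_triple h1 h2,
        LinearMap.sub_apply, bkt_tmul]
      abel

lemma mem_IU_left {I : Submodule F X} {x : X} (hx : x ∈ I) : (x, 0) ∈ IU I :=
  ⟨hx, zero_mem _⟩

lemma mem_IU_tmul {I : Submodule F X} {x : X} (hx : x ∈ I) (a : X) :
    (0, x ⊗ₜ a) ∈ IU I ∧ (0, a ⊗ₜ x) ∈ IU I :=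
  ⟨⟨zero_mem _, Submodule.subset_span (.inl ⟨x, hx, a, rfl⟩)⟩,
    ⟨zero_mem _, Submodule.subset_span (.inr ⟨x, hx, a, rfl⟩)⟩⟩

lemma IU_le {I : Submodule F X} {P : Submodule F (X × (X ⊗[F] X))}
    (h : ∀ x ∈ I, (x, 0) ∈ P ∧ ∀ a, (0, x ⊗ₜ a) ∈ P ∧ (0, a ⊗ₜ x) ∈ P) : IU I ≤ P := by
  have hi : iI I ≤ P.comap (LinearMap.inr F X (X ⊗[F] X)) := by
    refine Submodule.span_le.2 ?_
    rintro z (⟨x, hx, a, rfl⟩ | ⟨x, hx, a, rfl⟩)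
    exacts [((h x hx).2 a).1, ((h x hx).2 a).2]
  rintro ⟨x, w⟩ ⟨hx, hw⟩
  simpa using add_mem (h x hx).1 (hi hw)

lemma IU_bot : IU (⊥ : Submodule F X) = ⊥ := by
  refine eq_bot_iff.2 (IU_le fun x hx => ?_)
  rw [Submodule.mem_bot] at hx
  simp [hx]

lemma IU_top : IU (⊤ : Submodule F X) = ⊤ := by
  refine eq_top_iff.2 fun x _ => ?_
  induction x using envelope_induction with
  | left a => exact mem_IU_left trivial
  | tmul a b => exact (mem_IU_tmul (I := ⊤) trivial b).1
  | add x y hx hy => exact add_mem (hx trivial) (hy trivial)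

lemma bkt_tmul_tmul (a b c d : X) : bktHom t (0, a ⊗ₜ b) (0, c ⊗ₜ d)
    = (0, t a b c ⊗ₜ d) - (0, t a b d ⊗ₜ c) := by
  simp only [bkt_tmul, bkt_tmul_left, bkt_left]

lemma bkt_left_tmul (a c d : X) : bktHom t (a, 0) (0, c ⊗ₜ d) = (t a c d, 0) - (t a d c, 0) := by
  simp only [bkt_tmul, bkt_tmul_left, bkt_left]

lemma IsIdealT.bkt_mem_IU {I : Submodule F X} (hI : IsIdealT t I) :
    ∀ v ∈ IU I, ∀ u, bktHom t v u ∈ IU I ∧ bktHom t u v ∈ IU I := by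
  intro v hv u
  suffices h : IU I ≤ (IU I).comap ((bktHom t).flip u) ⊓ (IU I).comap (bktHom t u) from h hv
  refine IU_le fun x hx => ?_
  simp only [Submodule.mem_inf, Submodule.mem_comap, LinearMap.flip_apply]
  induction u using envelope_induction with
  | add u u' h h' =>
    simp only [map_add, LinearMap.add_apply]
    exact ⟨⟨add_mem h.1.1 h'.1.1, add_mem h.1.2 h'.1.2⟩, fun a =>
      ⟨⟨add_mem (h.2 a).1.1 (h'.2 a).1.1, add_mem (h.2 a).1.2 (h'.2 a).1.2⟩,
        ⟨add_mem (h.2 a).2.1 (h'.2 a).2.1, add_mem (h.2 a).2.2 (h'.2 a).2.2⟩⟩⟩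
  | left c =>
    simp only [bkt_left, bkt_left_tmul, bkt_tmul_left]
    exact ⟨mem_IU_tmul hx c, fun a =>
      ⟨⟨mem_IU_left (hI x hx a c).1,
        sub_mem (mem_IU_left (hI x hx c a).2.1) (mem_IU_left (hI x hx c a).2.2)⟩,
      ⟨mem_IU_left (hI x hx a c).2.1,
        sub_mem (mem_IU_left (hI x hx c a).2.2) (mem_IU_left (hI x hx c a).2.1)⟩⟩⟩
  | tmul c d =>
    simp only [bkt_tmul_left, bkt_left_tmul, bkt_tmul_tmul]
    exact ⟨⟨sub_mem (mem_IU_left (hI x hx c d).1) (mem_IU_left (hI x hx d c).1),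
        mem_IU_left (hI x hx c d).2.2⟩, fun a =>
      ⟨⟨sub_mem (mem_IU_tmul (hI x hx a c).1 d).1 (mem_IU_tmul (hI x hx a d).1 c).1,
        sub_mem (mem_IU_tmul (hI x hx c d).2.2 a).1 (mem_IU_tmul hx _).2⟩,
      ⟨sub_mem (mem_IU_tmul (hI x hx a c).2.1 d).1 (mem_IU_tmul (hI x hx a d).2.1 c).1,
        sub_mem (mem_IU_tmul hx _).2 (mem_IU_tmul (hI x hx c d).2.2 a).1⟩⟩⟩

lemma fst_mem_lowerSeries (I : Submodule F X) {k : ℕ} {v : X × (X ⊗[F] X)}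
    (hv : v ∈ lowerSeries (bktHom t) (IU I) k) :
    ((v.1, 0) : X × (X ⊗[F] X)) ∈ lowerSeries (bktHom t) (IU I) k := by
  induction k generalizing v with
  | zero => exact mem_IU_left hv.1
  | succ k ih =>
    suffices h : lowerSeries (bktHom t) (IU I) (k + 1) ≤
        (lowerSeries (bktHom t) (IU I) (k + 1)).comap
          (LinearMap.inl F X (X ⊗[F] X) ∘ₗ LinearMap.fst F X (X ⊗[F] X)) from h hv
    refine Submodule.map₂_le.2 fun v hv w hw => ?_
    have e : ((bktHom t v w).1, 0) = bktHom t (v.1, 0) (0, w.2) + bktHom t (0, v.2) (w.1, 0) := by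
      ext1 <;> simp [bktHom_apply, bkt]
      abel
    have hv2 : (0, v.2) ∈ lowerSeries (bktHom t) (IU I) k := by
      convert sub_mem hv (ih hv) using 1
      ext1 <;> simp
    change ((bktHom t v w).1, 0) ∈ lowerSeries (bktHom t) (IU I) (k + 1)
    rw [e]
    exact add_mem (Submodule.apply_mem_map₂ _ (ih hv) ⟨zero_mem _, hw.2⟩)
      (Submodule.apply_mem_map₂ _ hv2 (mem_IU_left hw.1))

lemma eq_zero_of_tmul_self_eq_zero {x : X} (h : x ⊗ₜ[F] x = 0) : x = 0 := by
  refine (Module.forall_dual_apply_eq_zero_iff F x).1 fun φ => ?_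
  have hφ := congrArg (LinearMap.mul' F F ∘ₗ TensorProduct.map φ φ) h
  simpa using hφ

lemma clsT_le_comap_lowerSeries (h1 : LTS1 t) (h2 : LTS2 t) {I : Submodule F X}
    (hI : IsIdealT t I) (k : ℕ) :
    clsT t I k ≤
      (lowerSeries (bktHom t) (IU I) k).comap (LinearMap.inl F X (X ⊗[F] X)) := by
  have hB : ∀ x y z, bktHom t (bktHom t x (bktHom t y z))
      = bktHom t (bktHom t (bktHom t x y) z) - bktHom t (bktHom t (bktHom t x z) y) :=
    fun x y z => LinearMap.ext (bkt_bkt_leibniz h1 h2 x y z)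
  have hV := hI.bkt_mem_IU
  induction k with
  | zero => exact fun x hx => mem_IU_left hx
  | succ k ih =>
    refine mixedSpan_le.2 fun x hx b hb c => ?_
    have triple : ∀ p q r : X, bktHom t (bktHom t (p, 0) (q, 0)) (r, 0) = (t p q r, 0) := by
      simp [bkt_left, bkt_tmul_left]
    have fst_mem : ∀ {p q r : X}, bktHom t (bktHom t (p, 0) (q, 0)) (r, 0) ∈
        lowerSeries (bktHom t) (IU I) (k + 1) ⊔ LinearMap.ker (bktHom t) →
        t p q r ∈ (lowerSeries (bktHom t) (IU I) (k + 1)).comap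
          (LinearMap.inl F X (X ⊗[F] X)) := by
      intro p q r h
      rw [triple] at h
      obtain ⟨v, hv, n, hn, e⟩ := Submodule.mem_sup.1 h
      have hn1 : n.1 = 0 := by
        have h0 : n.1 ⊗ₜ[F] n.1 = 0 := by
          simpa [bktHom_apply, bkt] using
            congrArg (fun f => (f (n.1, 0)).2) (LinearMap.mem_ker.1 hn)
        exact eq_zero_of_tmul_self_eq_zero h0
      have : v.1 = t p q r := by simpa [hn1] using congrArg Prod.fst e
      simpa [this] using fst_mem_lowerSeries I hv
    have hx' : (x, 0) ∈ lowerSeries (bktHom t) (IU I) k := ih hx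
    have hb' : (b, 0) ∈ IU I := mem_IU_left hb
    have hxW := Submodule.mem_sup_left (T := LinearMap.ker (bktHom t)) hx'
    refine ⟨fst_mem (bracket_right_mem hB hV (Submodule.mem_sup_left
        (bracket_mem_lowerSeries_succ hxW hb')) _),
      fst_mem (Submodule.mem_sup_left (bracket_mem_lowerSeries_succ
        (bracket_right_mem hB hV hxW _) hb')),
      fst_mem (bracket_right_mem hB hV ?_ _), fst_mem ?_,
      fst_mem (Submodule.mem_sup_left (bracket_mem_lowerSeries_succ
        (bracket_left_mem hB hV hx' _) hb')), fst_mem ?_⟩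
    · exact bracket_mem_lowerSeries_succ_right hB hb' hx'
    · exact bracket_mem_lowerSeries_succ_right hB (hV _ hb' (c, 0)).1 hx'
    · exact bracket_mem_lowerSeries_succ_right hB (hV _ hb' (c, 0)).2 hx'

lemma bkt_bkt_mem_IU_mixedSpan (h1 : LTS1 t) (h2 : LTS2 t) {A I : Submodule F X}
    (hA : IsIdealT t A) (hI : IsIdealT t I) : Submodule.map₂ (bktHom t)
      (Submodule.map₂ (bktHom t) (IU A) (IU I)) (IU I) ≤ IU (mixedSpan t A I) := by
  have hS := (isIdealT_mixedSpan h1 h2 hA hI).bkt_mem_IU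
  set S := mixedSpan t A I
  let Z : Submodule F (X × (X ⊗[F] X)) :=
    (Submodule.map₂ (TensorProduct.mk F X X) A I).map (LinearMap.inr F X (X ⊗[F] X))
  have hZ : ∀ a ∈ A, ∀ x ∈ I, ((0 : X), a ⊗ₜ[F] x) ∈ IU S ⊔ Z := fun a ha x hx =>
    Submodule.mem_sup_right ⟨_, Submodule.apply_mem_map₂ (TensorProduct.mk F X X) ha hx, rfl⟩
  have first : Submodule.map₂ (bktHom t) (IU A) (IU I) ≤ IU S ⊔ Z := by
    refine Submodule.map₂_le.2 fun v hv w hw => ?_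
    suffices h : IU A ≤ (IU S ⊔ Z).comap ((bktHom t).flip w) from h hv
    refine IU_le fun a ha => ?_
    suffices h : ∀ p, (p = (a, 0) ∨ ∃ d, p = (0, a ⊗ₜ d) ∨ p = (0, d ⊗ₜ a)) →
        IU I ≤ (IU S ⊔ Z).comap (bktHom t p) from
      ⟨h _ (.inl rfl) hw, fun d => ⟨h _ (.inr ⟨d, .inl rfl⟩) hw, h _ (.inr ⟨d, .inr rfl⟩) hw⟩⟩
    rintro p (rfl | ⟨d, rfl | rfl⟩) <;> refine IU_le fun x hx => ?_
    · simp only [Submodule.mem_comap, bkt_left, bkt_left_tmul]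
      refine ⟨hZ a ha x hx, fun c => ?_⟩
      obtain ⟨m1, m2, -⟩ := mem_mixedSpan (t := t) ha hx c
      exact ⟨Submodule.mem_sup_left (sub_mem (mem_IU_left m1) (mem_IU_left m2)),
        Submodule.mem_sup_left (sub_mem (mem_IU_left m2) (mem_IU_left m1))⟩
    · simp only [Submodule.mem_comap, bkt_tmul_left, bkt_tmul_tmul]
      obtain ⟨-, m, -⟩ := mem_mixedSpan (t := t) ha hx d
      have k := fun c => Submodule.mem_sup_left (T := Z) (mem_IU_tmul m c).1
      exact ⟨Submodule.mem_sup_left (mem_IU_left m), fun c =>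
        ⟨sub_mem (k c) (hZ _ (hA a ha d c).1 x hx), sub_mem (hZ _ (hA a ha d c).1 x hx) (k c)⟩⟩
    · simp only [Submodule.mem_comap, bkt_tmul_left, bkt_tmul_tmul]
      obtain ⟨-, -, -, -, m, -⟩ := mem_mixedSpan (t := t) ha hx d
      have k := fun c => Submodule.mem_sup_left (T := Z) (mem_IU_tmul m c).1
      exact ⟨Submodule.mem_sup_left (mem_IU_left m), fun c =>
        ⟨sub_mem (k c) (hZ _ (hA a ha d c).2.1 x hx),
          sub_mem (hZ _ (hA a ha d c).2.1 x hx) (k c)⟩⟩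
  have second : Submodule.map₂ (bktHom t) Z (IU I) ≤ IU S := by
    refine Submodule.map₂_le.2 fun v hv w hw => ?_
    suffices h : Z ≤ (IU S).comap ((bktHom t).flip w) from h hv
    refine Submodule.map_le_iff_le_comap.2 (Submodule.map₂_le.2 fun a ha y hy => ?_)
    suffices h : IU I ≤ (IU S).comap (bktHom t (0, a ⊗ₜ y)) from h hw
    refine IU_le fun x hx => ?_
    simp only [Submodule.mem_comap, bkt_tmul_left, bkt_tmul_tmul]
    have m := fun c => (mem_mixedSpan (t := t) ha hy c).1
    exact ⟨mem_IU_left (m x), fun c =>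
      ⟨sub_mem (mem_IU_tmul (m x) c).1 (mem_IU_tmul (m c) x).1,
        sub_mem (mem_IU_tmul (m c) x).1 (mem_IU_tmul (m x) c).1⟩⟩
  refine (Submodule.map₂_le_map₂_left first).trans ?_
  rw [Submodule.map₂_sup_left]
  exact sup_le (Submodule.map₂_le.2 fun v hv w _ => (hS v hv w).1) second

lemma lowerSeries_two_mul_le (h1 : LTS1 t) (h2 : LTS2 t) {I : Submodule F X}
    (hI : IsIdealT t I) (k : ℕ) :
    lowerSeries (bktHom t) (IU I) (2 * k) ≤ IU (clsT t I k) := by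
  induction k with
  | zero => exact le_rfl
  | succ k ih =>
    exact (Submodule.map₂_le_map₂_left (Submodule.map₂_le_map₂_left ih)).trans
      (bkt_bkt_mem_IU_mixedSpan h1 h2 (isIdealT_clsT h1 h2 hI k) hI)

lemma isNilT_iff_isNilU_IU (h1 : LTS1 t) (h2 : LTS2 t) {I : Submodule F X}
    (hI : IsIdealT t I) : IsNilT t I ↔ IsNilU t (IU I) := by
  constructor
  · rintro ⟨n, hn⟩
    refine ⟨2 * n, eq_bot_iff.2 ?_⟩
    rw [clsU_eq_lowerSeries, ← IU_bot, ← hn]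
    exact lowerSeries_two_mul_le h1 h2 hI n
  · rintro ⟨n, hn⟩
    refine ⟨n, eq_bot_iff.2 fun x hx => ?_⟩
    have h := clsT_le_comap_lowerSeries h1 h2 hI n hx
    rw [← clsU_eq_lowerSeries, hn] at h
    simpa using h

end TripleSystem

/-- (1) An ideal `I` of `T` is nilpotent iff `𝕀(I)` is a nilpotent ideal of
`U(T)`; in particular `T` is nilpotent iff `U(T)` is nilpotent.
(2) The sum of two nilpotent ideals of `T` is a nilpotent ideal. -/
theorem nilpotency_transfer
    (t : T →ₗ[K] T →ₗ[K] T →ₗ[K] T) (h1 : LTS1 t) (h2 : LTS2 t) :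
    (∀ I : Submodule K T, IsIdealT t I → (IsNilT t I ↔ IsNilU t (IU I))) ∧
    (IsNilT t (⊤ : Submodule K T) ↔
      IsNilU t (⊤ : Submodule K (T × (T ⊗[K] T)))) ∧
    (∀ I J : Submodule K T, IsIdealT t I → IsNilT t I →
      IsIdealT t J → IsNilT t J →
      IsIdealT t (I ⊔ J) ∧ IsNilT t (I ⊔ J)) := by
  refine ⟨fun I hI => isNilT_iff_isNilU_IU h1 h2 hI, ?_, fun I J hI hI' hJ hJ' =>
    ⟨isIdealT_sup hI hJ, isNilT_sup h1 h2 hI hI' hJ hJ'⟩⟩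
  rw [← IU_top]
  exact isNilT_iff_isNilU_IU h1 h2 fun _ _ _ _ => ⟨trivial, trivial, trivial⟩

end
end
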